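/- For every position G, v(G) > 4 if and only if c(G) > 4. -/

import Mathlib

namespace DotsAndBoxes

/-- A component of a Dots & Boxes endgame position: an `n`-chain or an `n`-loop. -/
inductive Component : Type where
  | chain (n : ℕ)
  | loop (n : ℕ)
deriving DecidableEq

namespace Component

/-- The number of boxes in a component. -/
def size : Component → ℕ
  | chain n => n
  | loop n => n

def isChain : Component → Bool
  | chain _ => true
  | loop _ => false

def isLoop : Component → Bool
  | chain _ => false
  | loop _ => true

/-- A chain must have length at least 3; a loop must have even length at least 4. -/
def Valid : Component → Prop
  | chain n => 3 ≤ n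
  | loop n => 4 ≤ n ∧ Even n

end Component

/-- A position is a finite multiset of components. -/
abbrev Position := Multiset Component

def Position.Valid (G : Position) : Prop := ∀ C ∈ G, C.Valid

/-- The number of unclaimed boxes in a position. -/
def size (G : Position) : ℕ := (G.map Component.size).sum

/-- The number of chains of a position. -/
def numChains (G : Position) : ℕ := Multiset.card (G.filter fun C => C.isChain = true)

/-- The number of loops of a position. -/
def numLoops (G : Position) : ℕ := Multiset.card (G.filter fun C => C.isLoop = true)

/-- θ(G), the number of 3-chains. -/
def theta (G : Position) : ℕ := G.count (Component.chain 3)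

/-- f(G), the number of 4-loops. -/
def numF (G : Position) : ℕ := G.count (Component.loop 4)

/-- s(G), the number of 6-loops. -/
def numS (G : Position) : ℕ := G.count (Component.loop 6)

open Classical in
/-- The terminal bonus tb(G). -/
noncomputable def tb (G : Position) : ℤ :=
  if G = 0 then 0
  else if ∀ C ∈ G, C.isLoop = true then 8
  else if (∃ C ∈ G, C.isLoop = true) ∧ Component.chain 3 ∈ G ∧
      (∀ C ∈ G, C.isChain = true → C = Component.chain 3) then 6
  else 4

/-- The controlled value c(G). -/
noncomputable def cval (G : Position) : ℤ :=
  (size G : ℤ) - 4 * (numChains G : ℤ) - 8 * (numLoops G : ℤ) + tb G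

/-- The score v(G;C) of opening component `C`, given that the remainder of the
position has value `w`. -/
def openVal (C : Component) (w : ℤ) : ℤ :=
  match C with
  | Component.chain n => ((n : ℤ) - 2) + |w - 2|
  | Component.loop n => ((n : ℤ) - 4) + |w - 4|

/-- Auxiliary recursion (on the number of components) for the value `v`. -/
noncomputable def valueAux : ℕ → Position → ℤ
  | 0, _ => 0
  | n + 1, G =>
    if G = 0 then 0
    else sInf { x : ℤ | ∃ C ∈ G, x = openVal C (valueAux n (G.erase C)) }

/-- The value v(G): v(∅) = 0, and v(G) = min over components C of G of v(G;C). -/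
noncomputable def value (G : Position) : ℤ := valueAux (Multiset.card G) G

/-- v(G;C), the value of G given that the opener has just opened C. -/
noncomputable def valueOpen (G : Position) (C : Component) : ℤ :=
  openVal C (value (G.erase C))

/-- Opening a component C of G is optimal if C ∈ G and v(G;C) = v(G). -/
def Optimal (G : Position) (C : Component) : Prop :=
  C ∈ G ∧ valueOpen G C = value G



open Component

lemma value_zero : value 0 = 0 := by simp [value, valueAux]

lemma openVal_nonneg (C : Component) (hC : C.Valid) (w : ℤ) : 0 ≤ openVal C w := by
  cases C with
  | chain n =>
    simp only [Component.Valid] at hC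
    simp only [openVal]
    have := abs_nonneg (w - 2)
    omega
  | loop n =>
    simp only [Component.Valid] at hC
    simp only [openVal]
    have := abs_nonneg (w - 4)
    omega

lemma value_eq (G : Position) (h : G ≠ 0) :
    value G = sInf { x : ℤ | ∃ C ∈ G, x = openVal C (value (G.erase C)) } := by
  unfold value
  obtain ⟨n, hn⟩ : ∃ n, Multiset.card G = n + 1 :=
    Nat.exists_eq_succ_of_ne_zero (by simpa using h)
  rw [hn, valueAux, if_neg h]
  congr 1
  ext x
  constructor
  · rintro ⟨C, hC, rfl⟩
    refine ⟨C, hC, ?_⟩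
    rw [Multiset.card_erase_of_mem hC, hn]; rfl
  · rintro ⟨C, hC, rfl⟩
    refine ⟨C, hC, ?_⟩
    rw [Multiset.card_erase_of_mem hC, hn]; rfl

lemma bddBelow_set (G : Position) (hG : G.Valid) :
    BddBelow { x : ℤ | ∃ C ∈ G, x = openVal C (value (G.erase C)) } := by
  refine ⟨0, ?_⟩
  rintro x ⟨C, hC, rfl⟩
  exact openVal_nonneg C (hG C hC) _

/-- Upper bound by any move. -/
lemma value_cons_le (C : Component) (H : Position) (hG : Position.Valid (C ::ₘ H)) :
    value (C ::ₘ H) ≤ openVal C (value H) := by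
  rw [value_eq _ (by simp)]
  refine csInf_le (bddBelow_set _ hG) ⟨C, by simp, by simp⟩

/-- Some move attains the value. -/
lemma exists_move (G : Position) (hG : G.Valid) (h : G ≠ 0) :
    ∃ C H, G = C ::ₘ H ∧ value G = openVal C (value H) := by
  obtain ⟨D, hD⟩ := Multiset.exists_mem_of_ne_zero h
  have := Int.csInf_mem (s := { x : ℤ | ∃ C ∈ G, x = openVal C (value (G.erase C)) })
    ⟨_, D, hD, rfl⟩ (bddBelow_set G hG)
  rw [← value_eq G h] at this
  obtain ⟨C, hC, h2⟩ := this
  exact ⟨C, G.erase C, (Multiset.cons_erase hC).symm, h2⟩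

lemma valid_cons {C : Component} {H : Position} :
    Position.Valid (C ::ₘ H) ↔ C.Valid ∧ H.Valid := by
  simp [Position.Valid]

lemma value_nonneg (G : Position) (hG : G.Valid) : 0 ≤ value G := by
  by_cases h : G = 0
  · simp [h, value_zero]
  · obtain ⟨C, H, rfl, h2⟩ := exists_move G hG h
    rw [h2]
    exact openVal_nonneg C (valid_cons.1 hG).1 _

lemma value_singleton (C : Component) (hC : C.Valid) : value {C} = C.size := by
  have hv : Position.Valid {C} := by simpa [Position.Valid] using hC
  obtain ⟨D, H, h1, h2⟩ := exists_move {C} hv (by simp)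
  have h3 : D = C ∧ H = 0 := by
    have : H = 0 := by
      have := congrArg Multiset.card h1
      simpa using this
    subst this
    simpa [eq_comm] using h1
  rw [h2, h3.1, h3.2, value_zero]
  cases C <;> simp [openVal, Component.size]

/-- base part of the controlled value -/
noncomputable def base (G : Position) : ℤ :=
  (size G : ℤ) - 4 * (numChains G : ℤ) - 8 * (numLoops G : ℤ)

lemma cval_eq (G : Position) : cval G = base G + tb G := rfl

lemma base_chain (n : ℕ) (H : Position) : base (chain n ::ₘ H) = base H + n - 4 := by
  have h1 : size (chain n ::ₘ H) = n + size H := by simp [size, Component.size]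
  have h2 : numChains (chain n ::ₘ H) = numChains H + 1 := by
    unfold numChains
    rw [Multiset.filter_cons_of_pos _ (by simp [isChain])]
    simp
  have h3 : numLoops (chain n ::ₘ H) = numLoops H + 0 := by
    unfold numLoops
    rw [Multiset.filter_cons_of_neg _ (by simp [isLoop])]
    simp
  unfold base
  rw [h1, h2, h3]
  push_cast
  ring

lemma base_loop (n : ℕ) (H : Position) : base (loop n ::ₘ H) = base H + n - 8 := by
  have h1 : size (loop n ::ₘ H) = n + size H := by simp [size, Component.size]
  have h2 : numChains (loop n ::ₘ H) = numChains H + 0 := by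
    unfold numChains
    rw [Multiset.filter_cons_of_neg _ (by simp [isChain])]
    simp
  have h3 : numLoops (loop n ::ₘ H) = numLoops H + 1 := by
    unfold numLoops
    rw [Multiset.filter_cons_of_pos _ (by simp [isLoop])]
    simp
  unfold base
  rw [h1, h2, h3]
  push_cast
  ring

lemma base_zero : base 0 = 0 := by
  simp [base, size, numChains, numLoops]

lemma tb_zero : tb 0 = 0 := by simp [tb]

lemma tb_ge (G : Position) (h : G ≠ 0) : 4 ≤ tb G := by
  unfold tb
  split_ifs <;> simp_all

lemma tb_loops (G : Position) (h : G ≠ 0) (hl : ∀ C ∈ G, C.isLoop = true) : tb G = 8 := by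
  unfold tb
  rw [if_neg h, if_pos hl]

lemma tb_chain_le (n : ℕ) (H : Position) (h : H ≠ 0) : tb (chain n ::ₘ H) ≤ tb H := by
  unfold tb
  rw [if_neg h, if_neg (by simp), if_neg (by simp [isLoop])]
  split_ifs with h1 h2 h3 h3 <;> try norm_num
  exfalso
  obtain ⟨⟨C, hC, hCl⟩, _, h5⟩ := h1
  apply h3
  have h6 : ∀ C ∈ H, C.isChain = true → C = chain 3 :=
    fun C hC => h5 C (Multiset.mem_cons_of_mem hC)
  refine ⟨⟨C, ?_, hCl⟩, ?_, h6⟩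
  · rcases Multiset.mem_cons.1 hC with rfl | h
    · simp [isLoop] at hCl
    · exact h
  · push Not at h2
    obtain ⟨D, hD, hDl⟩ := h2
    have : D.isChain = true := by cases D <;> simp_all [isLoop, isChain]
    exact h6 D hD this ▸ hD

/-- Adding a 3-chain to a position with a chain leaves the bonus unchanged. -/
lemma tb_three_ge (H : Position) (h : ∃ C ∈ H, C.isLoop = false) :
    tb (chain 3 ::ₘ H) = tb H := by
  obtain ⟨D, hD, hDl⟩ := h
  have hne : H ≠ 0 := by rintro rfl; simp at hD
  refine le_antisymm (tb_chain_le 3 H hne) ?_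
  unfold tb
  rw [if_neg hne, if_neg (c := chain 3 ::ₘ H = 0) (by simp),
    if_neg (c := ∀ C ∈ H, C.isLoop = true) (by intro h; simp [h D hD] at hDl),
    if_neg (c := ∀ C ∈ chain 3 ::ₘ H, C.isLoop = true) (by simp [isLoop])]
  split_ifs with h1 h2 h2 <;> try norm_num
  apply h2
  obtain ⟨⟨C, hC, hCl⟩, _, h5⟩ := h1
  refine ⟨⟨C, by simp [hC], hCl⟩, by simp, ?_⟩
  intro C hC h
  rcases Multiset.mem_cons.1 hC with rfl | h'
  · rfl
  · exact h5 C h' h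

lemma tb_loop_ge (n : ℕ) (H : Position) : tb H ≤ tb (loop n ::ₘ H) := by
  unfold tb
  rw [if_neg (c := loop n ::ₘ H = 0) (by simp)]
  split_ifs with h1 h2 h3 h4 h5 h6 h7 h8 h9 <;> try norm_num
  all_goals simp_all [isLoop, isChain]

lemma tb_loop_le (n : ℕ) (H : Position) (h : H ≠ 0) (h3 : ∃ C ∈ H, C ≠ chain 3) :
    tb (loop n ::ₘ H) ≤ tb H := by
  unfold tb
  rw [if_neg (c := loop n ::ₘ H = 0) (by simp), if_neg h]
  obtain ⟨D, hD, hD3⟩ := h3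
  split_ifs with h1 h2 h4 h5 h6 h7 <;> try norm_num
  · exact h2 fun C hC => h1 C (by simp [hC])
  · exact h2 fun C hC => h1 C (by simp [hC])
  · apply h7
    obtain ⟨_, h8, h9⟩ := h5
    have h10 : ∀ C ∈ H, C.isChain = true → C = chain 3 :=
      fun C hC => h9 C (Multiset.mem_cons_of_mem hC)
    refine ⟨⟨D, hD, ?_⟩, by simpa using h8, h10⟩
    cases D with
    | chain m => exact absurd (h10 _ hD rfl) hD3
    | loop m => rfl

lemma tb_chains (H : Position) (h : H ≠ 0) (hc : ∀ C ∈ H, C.isLoop = false) : tb H = 4 := by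
  obtain ⟨D, hD⟩ := Multiset.exists_mem_of_ne_zero h
  unfold tb
  rw [if_neg h, if_neg (by intro h; simpa [hc D hD] using h D hD), if_neg]
  rintro ⟨⟨C, hC, hCl⟩, _⟩
  simp [hc C hC] at hCl

lemma tb_loop_three (n : ℕ) (H : Position) (h : H ≠ 0) (hc : ∀ C ∈ H, C = chain 3) :
    tb (loop n ::ₘ H) = 6 := by
  obtain ⟨D, hD⟩ := Multiset.exists_mem_of_ne_zero h
  have h3 := hc D hD
  subst h3
  unfold tb
  rw [if_neg (by simp), if_neg, if_pos]
  · refine ⟨⟨loop n, by simp, rfl⟩, by simp [hD], ?_⟩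
    intro C hC hCc
    rcases Multiset.mem_cons.1 hC with rfl | h
    · simp [isChain] at hCc
    · exact hc C h
  · intro h
    simpa [isLoop] using h (chain 3) (by simp [hD])

lemma tb_three_loops (L : Position) (h : L ≠ 0) (hl : ∀ C ∈ L, C.isLoop = true) :
    tb (chain 3 ::ₘ L) = 6 := by
  obtain ⟨D, hD⟩ := Multiset.exists_mem_of_ne_zero h
  unfold tb
  rw [if_neg (by simp), if_neg (by simp [isLoop]), if_pos]
  refine ⟨⟨D, by simp [hD], hl D hD⟩, by simp, ?_⟩
  intro C hC hCc
  rcases Multiset.mem_cons.1 hC with rfl | h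
  · rfl
  · have := hl C h
    cases C <;> simp_all [isLoop, isChain]

lemma valid_of_threes {G : Position} (hc : ∀ C ∈ G, C = chain 3) : G.Valid := by
  intro C hC
  rw [hc C hC]
  simp [Component.Valid]

lemma value_threes (G : Position) (hc : ∀ C ∈ G, C = chain 3) : value G ≤ 3 := by
  induction G using Multiset.induction_on with
  | empty => simp [value_zero]
  | cons C H ih =>
    have hH : ∀ C ∈ H, C = chain 3 := fun C hC => hc C (by simp [hC])
    have h1 := ih hH
    have h0 := value_nonneg H (valid_of_threes hH)
    have h2 := value_cons_le C H (valid_of_threes hc)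
    rw [hc C (by simp)] at h2 ⊢
    simp only [openVal] at h2
    push_cast at h2
    grind

lemma cval_singleton (C : Component) : cval {C} = C.size := by
  rw [cval_eq, ← Multiset.cons_zero]
  cases C with
  | chain n =>
    rw [base_chain, base_zero, tb_chains _ (by simp) (by simp [isLoop])]
    simp [Component.size]
  | loop n =>
    rw [base_loop, base_zero, tb_loops _ (by simp) (by simp [isLoop])]
    simp [Component.size]

lemma cval_le_value (G : Position) (hG : G.Valid) : cval G ≤ value G := by
  induction hk : Multiset.card G generalizing G with
  | zero =>
    have : G = 0 := by simpa using hk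
    subst this
    simp [value_zero, cval_eq, base_zero, tb_zero]
  | succ k ih =>
    have hne : G ≠ 0 := by rintro rfl; simp at hk
    obtain ⟨C, H, rfl, h2⟩ := exists_move G hG hne
    have hv := valid_cons.1 hG
    have ihH := ih H hv.2 (by simpa using hk)
    by_cases hH : H = 0
    · subst hH
      rw [Multiset.cons_zero, value_singleton C hv.1, cval_singleton]
    rw [h2]
    rw [cval_eq] at ihH ⊢
    cases C with
    | chain n =>
      have := tb_chain_le n H hH
      rw [base_chain]
      simp only [openVal]
      have := le_abs_self (value H - 2)
      linarith
    | loop n =>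
      rw [base_loop]
      simp only [openVal]
      by_cases h3 : ∃ C ∈ H, C ≠ chain 3
      · have := tb_loop_le n H hH h3
        have := le_abs_self (value H - 4)
        linarith
      · push Not at h3
        have h4 := tb_loop_three n H hH h3
        have h5 := tb_chains H hH (by intro C hC; rw [h3 C hC]; rfl)
        have h6 := value_threes H h3
        have := neg_le_abs (value H - 4)
        linarith

/-- If there are no 3-chains and no 4-loops, every move costs at least 2. -/
lemma two_le_openVal (C : Component) (hC : C.Valid) (h3 : C ≠ chain 3) (h4 : C ≠ loop 4) (w : ℤ) :
    2 ≤ openVal C w := by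
  cases C with
  | chain n =>
    simp only [Component.Valid, ne_eq, chain.injEq] at hC h3
    simp only [openVal]
    have := abs_nonneg (w - 2)
    omega
  | loop n =>
    simp only [Component.Valid, ne_eq, loop.injEq] at hC h4
    obtain ⟨h5, m, rfl⟩ := hC
    simp only [openVal]
    have := abs_nonneg (w - 4)
    omega

lemma two_le_value (G : Position) (hG : G.Valid) (hne : G ≠ 0) (h3 : chain 3 ∉ G)
    (h4 : loop 4 ∉ G) : 2 ≤ value G := by
  obtain ⟨C, H, rfl, h2⟩ := exists_move G hG hne
  rw [h2]
  refine two_le_openVal C (valid_cons.1 hG).1 ?_ ?_ _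
  · rintro rfl; simp at h3
  · rintro rfl; simp at h4

/-- No short components: the base is nonnegative. -/
lemma base_nonneg (G : Position) (hG : G.Valid) (h3 : chain 3 ∉ G)
    (h4 : loop 4 ∉ G) (h6 : loop 6 ∉ G) : 0 ≤ base G := by
  induction G using Multiset.induction_on with
  | empty => simp [base_zero]
  | cons C H ih =>
    have hv := valid_cons.1 hG
    simp only [Multiset.mem_cons, not_or] at h3 h4 h6
    have := ih hv.2 h3.2 h4.2 h6.2
    cases C with
    | chain n =>
      rw [base_chain]
      have h1 := hv.1
      have h2 := h3.1
      simp only [Component.Valid, chain.injEq] at h1 h2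
      omega
    | loop n =>
      rw [base_loop]
      have h1 := hv.1
      have h2 := h4.1
      have h5 := h6.1
      simp only [Component.Valid, loop.injEq] at h1 h2 h5
      obtain ⟨h5, m, rfl⟩ := h1
      omega

lemma value_le (G : Position) (hG : G.Valid) : value G ≤ max 4 (cval G) := by
  induction hk : Multiset.card G generalizing G with
  | zero =>
    have : G = 0 := by simpa using hk
    subst this
    simp [value_zero]
  | succ k ih =>
    have hne : G ≠ 0 := by rintro rfl; simp at hk
    -- data about any removal
    have key : ∀ (C : Component) (H : Position), G = C ::ₘ H → value G ≤ openVal C (value H) ∧ C.Valid ∧ H.Valid ∧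
        value H ≤ max 4 (cval H) ∧ cval H ≤ value H ∧ 0 ≤ value H ∧ (H = 0 → value G = cval G) := by
      rintro C H rfl
      have hv := valid_cons.1 hG
      refine ⟨value_cons_le C H hG, hv.1, hv.2, ih H hv.2 (by simpa using hk),
        cval_le_value H hv.2, value_nonneg H hv.2, ?_⟩
      rintro rfl
      rw [Multiset.cons_zero, value_singleton C hv.1, cval_singleton]
    by_cases h4 : loop 4 ∈ G
    · obtain ⟨H, rfl⟩ := Multiset.exists_cons_of_mem h4
      obtain ⟨k1, -, -, k2, k3, k4, -⟩ := key _ _ rfl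
      have := tb_loop_ge 4 H
      simp only [cval_eq, base_loop, openVal] at *
      push_cast at *
      grind
    by_cases h3 : chain 3 ∈ G
    · obtain ⟨H, rfl⟩ := Multiset.exists_cons_of_mem h3
      obtain ⟨k1, -, hvH, k2, k3, k4, k5⟩ := key _ _ rfl
      by_cases hH : H = 0
      · exact le_max_of_le_right (k5 hH).le
      by_cases hc : ∃ C ∈ H, C.isLoop = false
      · have := tb_three_ge H hc
        simp only [cval_eq, base_chain, openVal] at *
        push_cast at *
        grind
      have hl : ∀ C ∈ H, C.isLoop = true := by simpa using hc
      have t1 := tb_three_loops H hH hl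
      have t2 := tb_loops H hH hl
      by_cases h6 : loop 6 ∈ H
      · by_cases hc3 : cval (chain 3 ::ₘ H) ≤ 2
        · simp only [cval_eq, base_chain, openVal] at *
          push_cast at *
          grind
        · obtain ⟨L, rfl⟩ := Multiset.exists_cons_of_mem h6
          obtain ⟨q1, -, -, q2, q3, q4, -⟩ :=
            key (loop 6) (chain 3 ::ₘ L) (Multiset.cons_swap _ _ _)
          have t3 : 4 ≤ tb (chain 3 ::ₘ L) := tb_ge _ (by simp)
          have t4 : tb (chain 3 ::ₘ L) ≤ 6 := by
            have := tb_loop_ge 6 (chain 3 ::ₘ L)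
            rw [Multiset.cons_swap] at this
            linarith
          clear ih key hc hl
          simp only [cval_eq, base_chain, base_loop, openVal] at *
          push_cast at *
          grind
      · obtain ⟨D, hD⟩ := Multiset.exists_mem_of_ne_zero hH
        have hDl := hl D hD
        obtain ⟨L, rfl⟩ := Multiset.exists_cons_of_mem hD
        cases D with
        | chain n => simp [isLoop] at hDl
        | loop n =>
        obtain ⟨q1, q0, -, q2, q3, q4, -⟩ :=
          key (loop n) (chain 3 ::ₘ L) (Multiset.cons_swap _ _ _)
        by_cases hL : L = 0
        · subst hL
          have s1 := value_singleton (chain 3) (by simp [Component.Valid])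
          rw [← Multiset.cons_zero] at s1
          rw [s1] at q1
          clear ih key hc hl
          have : 4 ≤ n := q0.1
          simp only [cval_eq, base_chain, base_loop, base_zero, openVal, Component.size] at *
          push_cast at *
          norm_num at *
          grind
        · have t3 := tb_three_loops L hL (fun C hC => hl C (by simp [hC]))
          have hb : 0 ≤ base L := by
            apply base_nonneg L (valid_cons.1 hvH).2
            · intro h
              simpa [isLoop] using hl _ (Multiset.mem_cons_of_mem h)
            · intro h; exact h4 (by simp [h])
            · intro h; exact h6 (by simp [h])
          clear ih key hc hl
          simp only [cval_eq, base_chain, base_loop, openVal] at *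
          push_cast at *
          grind
    by_cases h6 : loop 6 ∈ G
    · obtain ⟨H, rfl⟩ := Multiset.exists_cons_of_mem h6
      obtain ⟨k1, -, hvH, k2, k3, k4, k5⟩ := key _ _ rfl
      by_cases hH : H = 0
      · exact le_max_of_le_right (k5 hH).le
      have h2 := two_le_value H hvH hH (fun h => h3 (by simp [h])) (fun h => h4 (by simp [h]))
      have := tb_loop_ge 6 H
      simp only [cval_eq, base_loop, openVal] at *
      push_cast at *
      grind
    by_cases hl : ∃ C ∈ G, C.isLoop = true
    · obtain ⟨D, hD, hDl⟩ := hl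
      obtain ⟨H, rfl⟩ := Multiset.exists_cons_of_mem hD
      obtain ⟨k1, -, hvH, k2, k3, k4, k5⟩ := key _ _ rfl
      by_cases hH : H = 0
      · exact le_max_of_le_right (k5 hH).le
      have hb := base_nonneg H hvH (fun h => h3 (by simp [h])) (fun h => h4 (by simp [h]))
        (fun h => h6 (by simp [h]))
      have ht := tb_ge H hH
      cases D with
      | chain n => simp [isLoop] at hDl
      | loop n =>
      have := tb_loop_ge n H
      clear ih key
      simp only [cval_eq, base_loop, openVal] at *
      grind
    · obtain ⟨D, hD⟩ := Multiset.exists_mem_of_ne_zero hne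
      have hl' : ∀ C ∈ G, C.isLoop = false := by simpa using hl
      obtain ⟨H, rfl⟩ := Multiset.exists_cons_of_mem hD
      obtain ⟨k1, -, hvH, k2, k3, k4, k5⟩ := key _ _ rfl
      by_cases hH : H = 0
      · exact le_max_of_le_right (k5 hH).le
      have hb := base_nonneg H hvH (fun h => h3 (by simp [h])) (fun h => h4 (by simp [h]))
        (fun h => h6 (by simp [h]))
      have ht := tb_chains H hH (fun C hC => hl' C (by simp [hC]))
      have ht' := tb_chains _ hne hl'
      cases D with
      | loop n => exact absurd (hl' _ hD) (by simp [isLoop])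
      | chain n =>
      clear ih key
      simp only [cval_eq, base_chain, openVal] at *
      grind

/-- v(G) > 4 if and only if c(G) > 4. -/
theorem value_gt_four_iff (G : Position) (hG : G.Valid) :
    4 < value G ↔ 4 < cval G := by
  have h1 := cval_le_value G hG
  have h2 := value_le G hG
  constructor
  · intro h
    rcases le_max_iff.1 h2 with h3 | h3 <;> linarith
  · intro h
    linarith

end DotsAndBoxes
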